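/- Let f : F_2 × F_2 → {±1} be defined by f(x,y) = (−1)^{x+y+1}, let H be a finite simple graph of odd girth k, let α ∈ (0,1), and let 0 < ε < min(α, 1 − α). Writing c_k(H) for the number of edge sets S ⊆ E(H) that form a cycle of length k, we have t_H(1 − α − εf) ≤ (1 − α)^{e(H)} + ε^k (1 − α)^{e(H)−k} c_k(H) + 2^{e(H)} ε^{k+1}. -/

import Mathlib

open Finset SimpleGraph

noncomputable section

/-- `f(x,y) = (-1)^(x+y+1)`, identifying elements of `F₂` with `0` and `1`. -/
def fWitness : ZMod 2 → ZMod 2 → ℝ := fun x y => (-1) ^ (x.val + y.val + 1)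

/-- The ordered-pair representatives `(v, w)` with `v < w` of the edges in `S`. -/
def edgePairs {V : Type} [Fintype V] [LinearOrder V] (S : Finset (Sym2 V)) :
    Finset (V × V) :=
  Finset.univ.filter fun p : V × V => p.1 < p.2 ∧ s(p.1, p.2) ∈ S

/-- `E_{x ∈ F₂^V} ∏_{vw ∈ S} g (x v) (x w)`, the expectation taken with respect to the
uniform measure on `F₂^V`. -/
def edgeExpect {V : Type} [Fintype V] [LinearOrder V] (S : Finset (Sym2 V))
    (g : ZMod 2 → ZMod 2 → ℝ) : ℝ :=
  (∑ x : V → ZMod 2, ∏ p ∈ edgePairs S, g (x p.1) (x p.2)) / 2 ^ Fintype.card V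

/-- The homomorphism density `t_H(g)` of `H` in `g : F₂ × F₂ → ℝ`. -/
def homDensity {V : Type} [Fintype V] [LinearOrder V] (H : SimpleGraph V)
    [DecidableRel H.Adj] (g : ZMod 2 → ZMod 2 → ℝ) : ℝ :=
  edgeExpect H.edgeFinset g

/-- `S` is exactly the edge set of a cycle of length `k` in `H`. -/
def IsCycleEdgeSet {V : Type} [DecidableEq V] (H : SimpleGraph V) (k : ℕ) (S : Finset (Sym2 V)) : Prop :=
  ∃ (u : V) (w : H.Walk u u), w.IsCycle ∧ w.length = k ∧ S = w.edges.toFinset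

/-- The number of edge sets `S ⊆ E(H)` forming a cycle of length `k` in `H`. -/
def cycleCount {V : Type} [DecidableEq V] (H : SimpleGraph V) (k : ℕ) : ℕ :=
  Nat.card {S : Finset (Sym2 V) // IsCycleEdgeSet H k S}

/-- `H` is isomorphic to a cycle graph. -/
def IsCycleGraph {V : Type} (H : SimpleGraph V) : Prop :=
  ∃ n : ℕ, Nonempty (H ≃g cycleGraph n)

end

noncomputable def chiE {V : Type} (x : V → ZMod 2) : Sym2 V → ℝ :=
  Sym2.lift ⟨fun v w => - fWitness (x v) (x w), fun a b => by simp only [fWitness, add_comm]⟩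

theorem chiE_mk {V : Type} (x : V → ZMod 2) (a b : V) :
    chiE x s(a, b) = - fWitness (x a) (x b) := rfl

theorem fW_left (a b : ZMod 2) : fWitness (a + 1) b = - fWitness a b := by
  have h : ∀ a : ZMod 2, (a = 0 ∧ (a + 1).val = 1 ∧ a.val = 0) ∨
      (a = 1 ∧ (a + 1).val = 0 ∧ a.val = 1) := by decide
  rcases h a with ⟨-, h1, h2⟩ | ⟨-, h1, h2⟩ <;> simp only [fWitness, h1, h2] <;> ring

theorem fW_comm (a b : ZMod 2) : fWitness a b = fWitness b a := by
  simp only [fWitness, add_comm]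

theorem fW_right (a b : ZMod 2) : fWitness a (b + 1) = - fWitness a b := by
  rw [fW_comm, fW_left, fW_comm]

theorem chiE_le {V : Type} (x : V → ZMod 2) (e : Sym2 V) : |chiE x e| = 1 := by
  induction e using Sym2.ind with
  | _ a b => simp [chiE_mk, fWitness]

theorem prod_pairs {V : Type} [Fintype V] [LinearOrder V] (H : SimpleGraph V)
    [DecidableRel H.Adj] (α ε : ℝ) (x : V → ZMod 2) :
    ∏ p ∈ edgePairs H.edgeFinset, (1 - α - ε * fWitness (x p.1) (x p.2))
      = ∏ e ∈ H.edgeFinset, (ε * chiE x e + (1 - α)) := by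
  refine Finset.prod_bij (fun p _ => s(p.1, p.2)) ?_ ?_ ?_ ?_
  · intro p hp
    simp only [edgePairs, Finset.mem_filter] at hp
    exact hp.2.2
  · rintro ⟨a, b⟩ hp ⟨c, d⟩ hq h
    simp only [edgePairs, Finset.mem_filter] at hp hq
    rcases Sym2.eq_iff.1 h with h | h
    · simp_all
    · obtain ⟨h1, h2⟩ := h
      simp only at h1 h2
      subst h1 h2
      exact absurd hp.2.1 (lt_asymm hq.2.1)
  · intro e he
    induction e using Sym2.ind with
    | _ a b =>
      have hab : H.Adj a b := by simpa using he
      rcases lt_or_gt_of_ne hab.ne with h | h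
      · exact ⟨(a, b), by simp [edgePairs, h, hab], rfl⟩
      · exact ⟨(b, a), by simp [edgePairs, h, hab.symm], Sym2.eq_swap⟩
  · intro p _
    rw [chiE_mk]; ring

/-- the Fourier coefficient -/
noncomputable def coef {V : Type} [Fintype V] [DecidableEq V] (S : Finset (Sym2 V)) : ℝ :=
  (∑ x : V → ZMod 2, ∏ e ∈ S, chiE x e) / 2 ^ Fintype.card V

theorem coef_le_one {V : Type} [Fintype V] [DecidableEq V] (S : Finset (Sym2 V)) :
    coef S ≤ 1 := by
  rw [coef, div_le_one (by positivity)]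
  calc _ ≤ ∑ x : V → ZMod 2, (1 : ℝ) := by
        refine Finset.sum_le_sum fun x _ => (le_abs_self _).trans ?_
        rw [Finset.abs_prod]
        simp [chiE_le]
    _ = _ := by simp [ZMod.card]

theorem homDensity_eq {V : Type} [Fintype V] [LinearOrder V] (H : SimpleGraph V)
    [DecidableRel H.Adj] (α ε : ℝ) :
    homDensity H (fun x y => 1 - α - ε * fWitness x y)
      = ∑ S ∈ H.edgeFinset.powerset,
        ε ^ S.card * (1 - α) ^ (H.edgeFinset.card - S.card) * coef S := by
  rw [homDensity, edgeExpect]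
  simp only [prod_pairs, Finset.prod_add]
  rw [Finset.sum_comm, Finset.sum_div]
  refine Finset.sum_congr rfl fun S hS => ?_
  rw [coef, mul_div_assoc', Finset.mul_sum]
  congr 1
  refine Finset.sum_congr rfl fun x _ => ?_
  rw [Finset.prod_mul_distrib, Finset.prod_const, Finset.prod_const,
    Finset.card_sdiff_of_subset (Finset.mem_powerset.1 hS)]
  ring

theorem coef_bridge {V : Type} [Fintype V] [DecidableEq V] (S : Finset (Sym2 V))
    (a b : V) (hab : s(a, b) ∈ S)
    (hbr : (SimpleGraph.fromEdgeSet (S : Set (Sym2 V))).IsBridge s(a, b)) :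
    coef S = 0 := by
  classical
  rw [SimpleGraph.isBridge_iff] at hbr
  set G := (SimpleGraph.fromEdgeSet (S : Set (Sym2 V))).deleteEdges {s(a, b)} with hG
  let d : V → ZMod 2 := fun v => if G.Reachable a v then 1 else 0
  have key : ∀ x : V → ZMod 2, ∏ e ∈ S, chiE (x + d) e = - ∏ e ∈ S, chiE x e := by
    intro x
    rw [← Finset.mul_prod_erase S _ hab, ← Finset.mul_prod_erase S (chiE x) hab, ← neg_mul]
    congr 1
    · simp [chiE_mk, d, hbr, fW_left]
    · refine Finset.prod_congr rfl fun e he => ?_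
      induction e using Sym2.ind with
      | _ u v =>
        rw [Finset.mem_erase] at he
        by_cases huv : u = v
        · subst huv
          by_cases h : G.Reachable a u <;> simp [chiE_mk, d, h, fW_left, fW_right]
        have hadj : G.Adj u v := by
          rw [hG, SimpleGraph.deleteEdges_adj, SimpleGraph.fromEdgeSet_adj]
          exact ⟨⟨he.2, huv⟩, by simpa using he.1⟩
        have hiff : G.Reachable a u ↔ G.Reachable a v :=
          ⟨fun h => h.trans hadj.reachable, fun h => h.trans hadj.symm.reachable⟩
        by_cases h : G.Reachable a v <;> simp [chiE_mk, d, h, hiff, fW_left, fW_right]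
  have h0 : ∑ x : V → ZMod 2, ∏ e ∈ S, chiE x e = - ∑ x : V → ZMod 2, ∏ e ∈ S, chiE x e := by
    rw [← Finset.sum_neg_distrib]
    rw [← Equiv.sum_comp (Equiv.addRight d)]
    exact Finset.sum_congr rfl fun x _ => key x
  rw [coef, div_eq_zero_iff]
  left
  linarith

theorem coef_cases {V : Type} [Fintype V] [DecidableEq V] (H : SimpleGraph V)
    [DecidableRel H.Adj] (k : ℕ) (hgirth : H.egirth = k) (S : Finset (Sym2 V))
    (hS : S ⊆ H.edgeFinset) :
    S = ∅ ∨ coef S = 0 ∨ (S.card = k ∧ IsCycleEdgeSet H k S) ∨ k + 1 ≤ S.card := by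
  rcases S.eq_empty_or_nonempty with h | ⟨e, he⟩
  · exact Or.inl h
  right
  by_cases hbr : (SimpleGraph.fromEdgeSet (S : Set (Sym2 V))).IsBridge e
  · left
    induction e using Sym2.ind with
    | _ a b => exact coef_bridge S a b he hbr
  right
  have hle : SimpleGraph.fromEdgeSet (S : Set (Sym2 V)) ≤ H := by
    intro a b h
    rw [SimpleGraph.fromEdgeSet_adj] at h
    simpa using hS h.1
  have heG : e ∈ (SimpleGraph.fromEdgeSet (S : Set (Sym2 V))).edgeSet := by
    rw [SimpleGraph.edgeSet_fromEdgeSet]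
    exact ⟨he, H.not_isDiag_of_mem_edgeSet (SimpleGraph.mem_edgeFinset.1 (hS he))⟩
  rw [SimpleGraph.isBridge_iff_forall_cycle_notMem heG] at hbr
  push Not at hbr
  obtain ⟨u, p, hp, -⟩ := hbr
  have hc := hp.mapLe hle
  have hk : k ≤ p.length := by
    have := SimpleGraph.le_egirth.1 hgirth.ge u _ hc
    simpa using this
  have hsub : p.edges.toFinset ⊆ S := by
    intro e he
    have := p.edges_subset_edgeSet (List.mem_toFinset.1 he)
    rw [SimpleGraph.edgeSet_fromEdgeSet] at this
    exact this.1
  have hcard : p.edges.toFinset.card = p.length := by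
    rw [List.toFinset_card_of_nodup hp.isTrail.edges_nodup, SimpleGraph.Walk.length_edges]
  have hle2 := Finset.card_le_card hsub
  by_cases h : S.card = k
  · left
    refine ⟨h, u, p.mapLe hle, hc, ?_, ?_⟩
    · simp; omega
    · rw [SimpleGraph.Walk.edges_mapLe_eq_edges]
      exact (Finset.eq_of_subset_of_card_le hsub (by omega)).symm
  · right; omega

theorem stmt8_upper_bound_complement {V : Type} [Fintype V] [LinearOrder V] (H : SimpleGraph V) [DecidableRel H.Adj]
    (k : ℕ) (hgirth : H.egirth = k) (hodd : Odd k)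
    (α ε : ℝ) (hα : α ∈ Set.Ioo (0 : ℝ) 1) (hε : 0 < ε) (hε' : ε < min α (1 - α)) :
    homDensity H (fun x y => 1 - α - ε * fWitness x y)
      ≤ (1 - α) ^ H.edgeFinset.card + ε ^ k * (1 - α) ^ (H.edgeFinset.card - k) * (cycleCount H k : ℝ)
          + 2 ^ H.edgeFinset.card * ε ^ (k + 1) := by
  classical
  obtain ⟨hα0, hα1⟩ := hα
  have hε1 : ε < 1 := (hε'.trans_le (min_le_left _ _)).trans hα1
  have ha0 : 0 ≤ 1 - α := by linarith
  have ha1 : 1 - α ≤ 1 := by linarith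
  rw [homDensity_eq]
  set n := H.edgeFinset.card with hn
  have hterm : ∀ S ∈ H.edgeFinset.powerset,
      ε ^ S.card * (1 - α) ^ (n - S.card) * coef S ≤
        (if S = ∅ then (1 - α) ^ n else 0)
        + (if IsCycleEdgeSet H k S then ε ^ k * (1 - α) ^ (n - k) else 0) + ε ^ (k + 1) := by
    intro S hS
    have h1 : 0 ≤ (if S = ∅ then (1 - α) ^ n else 0) := by split_ifs <;> positivity
    have h2 : 0 ≤ (if IsCycleEdgeSet H k S then ε ^ k * (1 - α) ^ (n - k) else 0) := by
      split_ifs <;> positivity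
    have h3 : 0 ≤ ε ^ (k + 1) := by positivity
    have hc : ε ^ S.card * (1 - α) ^ (n - S.card) * coef S
        ≤ ε ^ S.card * (1 - α) ^ (n - S.card) :=
      mul_le_of_le_one_right (by positivity) (coef_le_one S)
    rcases coef_cases H k hgirth S (Finset.mem_powerset.1 hS) with h | h | ⟨h, h'⟩ | h
    · subst h
      simp only [if_true, Finset.card_empty, pow_zero, one_mul, Nat.sub_zero] at hc ⊢
      linarith
    · rw [h, mul_zero]; positivity
    · rw [h] at hc ⊢
      rw [if_pos h'] at h2 ⊢
      linarith
    · have : ε ^ S.card * (1 - α) ^ (n - S.card) ≤ ε ^ (k + 1) * 1 :=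
        mul_le_mul (pow_le_pow_of_le_one hε.le hε1.le h) (pow_le_one₀ ha0 ha1)
          (by positivity) h3
      linarith
  refine (Finset.sum_le_sum hterm).trans ?_
  rw [Finset.sum_add_distrib, Finset.sum_add_distrib]
  have e1 : ∑ S ∈ H.edgeFinset.powerset, (if S = ∅ then (1 - α) ^ n else 0) = (1 - α) ^ n := by
    simp
  have e3 : ∑ S ∈ H.edgeFinset.powerset, ε ^ (k + 1) = 2 ^ n * ε ^ (k + 1) := by
    simp [hn]
  have e2 : ∑ S ∈ H.edgeFinset.powerset,
      (if IsCycleEdgeSet H k S then ε ^ k * (1 - α) ^ (n - k) else 0)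
      ≤ ε ^ k * (1 - α) ^ (n - k) * (cycleCount H k : ℝ) := by
    rw [← Finset.sum_filter, Finset.sum_const, nsmul_eq_mul, mul_comm]
    refine mul_le_mul_of_nonneg_left ?_ (by positivity)
    rw [cycleCount, Nat.card_eq_fintype_card, Fintype.card_subtype]
    exact_mod_cast Finset.card_le_card (Finset.filter_subset_filter _ (Finset.subset_univ _))
  linarith
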